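/- arXiv:math/0410548 — 6 statements merged into one kernel-verified Lean document; each statement's English description precedes it below -/
import Mathlib

section
/- Let b : ℕ → ℂ be a sequence (indexed from 1), and let s ≥ 1 and q ≥ 2 be integers. Then K(q+s, B_{q+s}^{s+1}) = b_1 · K(q+s−1, B_{q+s−1}^{s}) + Σ_{m=2}^{q−1} b_m · K(q+s−m, B_{q+s−m}^{s}) + b_q · b_1^{s}. -/
open Polynomial Finset

lemma aux_trunc (b : ℕ → ℂ) (s N M : ℕ) (h : N ≤ M) :
    ((∑ m ∈ Finset.Icc 1 M, Polynomial.C (b m) * Polynomial.X ^ m) ^ s).coeff N =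
    ((∑ m ∈ Finset.Icc 1 N, Polynomial.C (b m) * Polynomial.X ^ m) ^ s).coeff N := by
  have h1 : (X : ℂ[X]) ^ (N + 1) ∣ (∑ m ∈ Finset.Icc 1 M, C (b m) * X ^ m)
      - (∑ m ∈ Finset.Icc 1 N, C (b m) * X ^ m) := by
    rw [← Finset.sum_sdiff (Finset.Icc_subset_Icc_right h : Finset.Icc 1 N ⊆ Finset.Icc 1 M),
      add_sub_cancel_right]
    refine Finset.dvd_sum fun m hm => ?_
    simp only [Finset.mem_sdiff, Finset.mem_Icc] at hm
    exact Dvd.dvd.mul_left (pow_dvd_pow _ (by omega)) _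
  have h2 := h1.trans (sub_dvd_pow_sub_pow _ _ s)
  have h3 := (X_pow_dvd_iff.1 h2) N (by omega)
  rw [coeff_sub] at h3
  exact sub_eq_zero.1 h3

lemma aux_factor (b : ℕ → ℂ) (n : ℕ) :
    (∑ m ∈ Finset.Icc 1 n, Polynomial.C (b m) * Polynomial.X ^ m) =
      X * ∑ m ∈ Finset.Icc 1 n, Polynomial.C (b m) * Polynomial.X ^ (m - 1) := by
  rw [Finset.mul_sum]
  refine Finset.sum_congr rfl fun m hm => ?_
  obtain ⟨k, rfl⟩ : ∃ k, m = k + 1 := ⟨m - 1, by simp at hm; omega⟩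
  simp only [Nat.add_sub_cancel]
  ring

lemma aux_zero (b : ℕ → ℂ) (n s d : ℕ) (h : d < s) :
    ((∑ m ∈ Finset.Icc 1 n, Polynomial.C (b m) * Polynomial.X ^ m) ^ s).coeff d = 0 := by
  rw [aux_factor, mul_pow]
  exact X_pow_dvd_iff.1 (dvd_mul_right _ _) d h

lemma aux_diag (b : ℕ → ℂ) (n s : ℕ) (h : 1 ≤ n) :
    ((∑ m ∈ Finset.Icc 1 n, Polynomial.C (b m) * Polynomial.X ^ m) ^ s).coeff s = b 1 ^ s := by
  rw [aux_factor, mul_pow, coeff_X_pow_mul', if_pos le_rfl, Nat.sub_self, coeff_zero_eq_eval_zero,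
    eval_pow, eval_finset_sum, Finset.sum_eq_single 1]
  · simp
  · intro m hm h1
    simp only [Finset.mem_Icc] at hm
    simp [zero_pow (show m - 1 ≠ 0 by omega)]
  · intro h2
    simp at h2
    omega

/-- For `s ≥ 1` and `q ≥ 2`,
`K(q+s, B_{q+s}^{s+1}) = b 1 * K(q+s-1, B_{q+s-1}^{s}) + ∑_{m=2}^{q-1} b m * K(q+s-m, B_{q+s-m}^{s}) + b q * (b 1)^s`,
where `B_q^r = (∑_{m=1}^{q} b m • X^m)^r` and `K(d, ·)` is the coefficient of `X^d`. -/
theorem coeff_recursion (b : ℕ → ℂ) (s q : ℕ) (hs : 1 ≤ s) (hq : 2 ≤ q) :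
    ((∑ m ∈ Finset.Icc 1 (q + s), Polynomial.C (b m) * Polynomial.X ^ m) ^ (s + 1)).coeff (q + s) =
      b 1 * ((∑ m ∈ Finset.Icc 1 (q + s - 1), Polynomial.C (b m) * Polynomial.X ^ m) ^ s).coeff (q + s - 1)
      + ∑ m ∈ Finset.Icc 2 (q - 1),
          b m * ((∑ j ∈ Finset.Icc 1 (q + s - m), Polynomial.C (b j) * Polynomial.X ^ j) ^ s).coeff (q + s - m)
      + b q * (b 1) ^ s := by
  have key : ((∑ m ∈ Finset.Icc 1 (q + s), C (b m) * X ^ m) ^ (s + 1)).coeff (q + s) =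
      ∑ m ∈ Finset.Icc 1 (q + s),
        b m * ((∑ j ∈ Finset.Icc 1 (q + s - m), C (b j) * X ^ j) ^ s).coeff (q + s - m) := by
    rw [pow_succ', Finset.sum_mul, finset_sum_coeff]
    refine Finset.sum_congr rfl fun m hm => ?_
    simp only [Finset.mem_Icc] at hm
    rw [mul_assoc, coeff_C_mul, coeff_X_pow_mul', if_pos hm.2, aux_trunc b s _ _ (Nat.sub_le _ _)]
  have hsub : Finset.Icc 1 q ⊆ Finset.Icc 1 (q + s) := Finset.Icc_subset_Icc_right (by omega)
  rw [key, ← Finset.sum_subset hsub]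
  · have e : Finset.Icc 1 q = insert 1 (insert q (Finset.Icc 2 (q - 1))) := by
      ext m
      simp only [Finset.mem_insert, Finset.mem_Icc]
      omega
    rw [e, Finset.sum_insert, Finset.sum_insert, Nat.add_sub_cancel_left, aux_diag b s s hs]
    · ring
    · simp only [Finset.mem_Icc]
      omega
    · simp only [Finset.mem_insert, Finset.mem_Icc]
      omega
  · intro m hm hm'
    simp only [Finset.mem_Icc] at hm hm'
    rw [aux_zero b _ s _ (by omega), mul_zero]
end

section
/- Let μ > 0, let m ≥ 1 be an integer, and let u_1, …, u_m be nonnegative reals; extend to a sequence (u_q)_{q≥1} by u_q = μ · Σ_{p=1}^{q−1} u_p · u_{q−p} for q ≥ m+1 (a μ-convolution of order m). Set v_1 = max_{k=1,…,m} (u_k / (C_{k−1} · μ^{k−1}))^{1/k}. Then for every integer q ≥ 1, u_q ≤ v_1^{q} · μ^{q−1} · C_{q−1}. -/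
open Finset

/-- The `r`-th Catalan number `C_r = (2r)! / ((r+1)! r!)`. -/
noncomputable def catalanC (r : ℕ) : ℝ :=
  (Nat.factorial (2 * r) : ℝ) / ((Nat.factorial (r + 1) : ℝ) * (Nat.factorial r : ℝ))

theorem catalanC_eq (r : ℕ) : catalanC r = (catalan r : ℝ) := by
  unfold catalanC
  have h1 : ((r : ℝ) + 1) * (catalan r : ℝ) = (r.centralBinom : ℝ) := by
    exact_mod_cast succ_mul_catalan_eq_centralBinom r
  have h2 : (r.centralBinom : ℝ) * (r.factorial : ℝ) * (r.factorial : ℝ)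
      = ((2 * r).factorial : ℝ) := by
    have := Nat.choose_mul_factorial_mul_factorial (show r ≤ 2 * r by omega)
    rw [show 2 * r - r = r by omega] at this
    rw [Nat.centralBinom]
    exact_mod_cast this
  have h3 : (r.factorial : ℝ) ≠ 0 := by positivity
  rw [← h2, ← h1, Nat.factorial_succ]
  push_cast
  field_simp

theorem catalanC_pos (r : ℕ) : 0 < catalanC r := by
  unfold catalanC
  positivity

theorem catalanC_succ (n : ℕ) :
    catalanC (n + 1) = ∑ i ∈ Finset.range (n + 1), catalanC i * catalanC (n - i) := by
  simp only [catalanC_eq]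
  rw [catalan_succ, Finset.sum_range]
  push_cast
  rfl

/-- A `μ`-convolution of order `m ≥ 1` with nonnegative initial terms is bounded by the
`μ`-convolution of order 1 with initial term
`v₁ = max_{k=1..m} (u k / (C_{k-1} μ^{k-1}))^{1/k}`:  `u q ≤ v₁^q * μ^{q-1} * C_{q-1}`. -/
theorem mu_convolution_bound (μ : ℝ) (hμ : 0 < μ) (m : ℕ) (hm : 1 ≤ m) (u : ℕ → ℝ)
    (hu : ∀ k : ℕ, 1 ≤ k → k ≤ m → 0 ≤ u k)
    (hrec : ∀ q : ℕ, m + 1 ≤ q → u q = μ * ∑ p ∈ Finset.Icc 1 (q - 1), u p * u (q - p)) :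
    ∀ q : ℕ, 1 ≤ q →
      u q ≤ ((Finset.Icc 1 m).sup' (Finset.nonempty_Icc.mpr hm)
          (fun k => (u k / (catalanC (k - 1) * μ ^ (k - 1))) ^ ((1 : ℝ) / k))) ^ q
        * μ ^ (q - 1) * catalanC (q - 1) := by
  set v := (Finset.Icc 1 m).sup' (Finset.nonempty_Icc.mpr hm)
          (fun k => (u k / (catalanC (k - 1) * μ ^ (k - 1))) ^ ((1 : ℝ) / k)) with hv
  have hle : ∀ k : ℕ, 1 ≤ k → k ≤ m →
      (u k / (catalanC (k - 1) * μ ^ (k - 1))) ^ ((1 : ℝ) / k) ≤ v := by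
    intro k h1 h2
    exact Finset.le_sup' (fun k : ℕ => (u k / (catalanC (k - 1) * μ ^ (k - 1))) ^ ((1 : ℝ) / k))
      (Finset.mem_Icc.mpr ⟨h1, h2⟩)
  clear_value v
  have key : ∀ q : ℕ, 1 ≤ q → 0 ≤ u q ∧ u q ≤ v ^ q * μ ^ (q - 1) * catalanC (q - 1) := by
    intro q
    induction q using Nat.strong_induction_on with
    | _ q ih =>
      intro hq
      by_cases hqm : q ≤ m
      · refine ⟨hu q hq hqm, ?_⟩
        have hc : 0 < catalanC (q - 1) * μ ^ (q - 1) :=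
          mul_pos (catalanC_pos _) (pow_pos hμ _)
        have hx : 0 ≤ u q / (catalanC (q - 1) * μ ^ (q - 1)) := div_nonneg (hu q hq hqm) hc.le
        have h1 := pow_le_pow_left₀ (Real.rpow_nonneg hx _) (hle q hq hqm) q
        rw [one_div, Real.rpow_inv_natCast_pow hx (by omega), div_le_iff₀ hc] at h1
        linarith
      · obtain ⟨n, rfl⟩ : ∃ n, q = n + 2 := ⟨q - 2, by omega⟩
        have hs : u (n + 2) = μ * ∑ i ∈ Finset.range (n + 1), u (i + 1) * u (n - i + 1) := by
          rw [hrec _ (by omega)]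
          congr 1
          rw [Finset.range_eq_Ico, show n + 2 - 1 = n + 1 from rfl]
          have := Finset.sum_Ico_add' (fun p => u p * u (n + 2 - p)) 0 (n + 1) 1
          rw [show Finset.Icc 1 (n + 1) = Finset.Ico (0 + 1) (n + 1 + 1) from rfl, ← this]
          refine Finset.sum_congr rfl fun i hi => ?_
          rw [Finset.mem_Ico] at hi
          rw [show n + 2 - (i + 1) = n - i + 1 by omega]
        rw [hs]
        constructor
        · refine mul_nonneg hμ.le (Finset.sum_nonneg fun i hi => ?_)
          rw [Finset.mem_range] at hi
          exact mul_nonneg (ih _ (by omega) (by omega)).1 (ih _ (by omega) (by omega)).1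
        · rw [show n + 2 - 1 = n + 1 from rfl, catalanC_succ, pow_succ μ n,
            show v ^ (n + 2) * (μ ^ n * μ) * ∑ i ∈ Finset.range (n + 1),
              catalanC i * catalanC (n - i) = μ * (v ^ (n + 2) * μ ^ n *
              ∑ i ∈ Finset.range (n + 1), catalanC i * catalanC (n - i)) by ring,
            Finset.mul_sum _ _ (v ^ (n + 2) * μ ^ n)]
          refine mul_le_mul_of_nonneg_left (Finset.sum_le_sum fun i hi => ?_) hμ.le
          rw [Finset.mem_range] at hi
          obtain ⟨a0, a1⟩ := ih (i + 1) (by omega) (by omega)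
          obtain ⟨b0, b1⟩ := ih (n - i + 1) (by omega) (by omega)
          refine (mul_le_mul a1 b1 b0 (a0.trans a1)).trans_eq ?_
          obtain ⟨j, rfl⟩ : ∃ j, n = i + j := ⟨n - i, by omega⟩
          simp only [Nat.add_sub_cancel_left, Nat.add_sub_cancel]
          ring
  exact fun q hq => (key q hq).2
end

section
/- Let n ≥ 2 be an integer and let M be the (n−1)×(n−1) real matrix with entries M_{ij} = i/n if i ≤ j and M_{ij} = −(n−i)/n if i > j (indices 1 ≤ i, j ≤ n−1). Let ‖M‖ = max_i Σ_j |M_{ij}| be its row-sum norm, and let z(u, n) = −2u² + (2n+1)u − n. Then ‖M‖ = (1/n) · max( z(⌊n/2 + 1/4⌋, n), z(⌈n/2 + 1/4⌉, n) ). -/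
open Finset

/-- The `(n-1) × (n-1)` real matrix with `M_{ij} = i/n` for `i ≤ j` and `M_{ij} = -(n-i)/n`
for `i > j` (1-based indices). -/
noncomputable def Mmat (n : ℕ) : Matrix (Fin (n - 1)) (Fin (n - 1)) ℝ :=
  fun i j => if (i : ℕ) ≤ (j : ℕ) then ((i : ℕ) + 1 : ℝ) / n
             else -((n : ℝ) - ((i : ℕ) + 1)) / n

/-- The row-sum norm `‖M‖ = max_i ∑_j |M_{ij}|`. -/
noncomputable def rowSumNorm (n : ℕ) : ℝ :=
  ⨆ i : Fin (n - 1), ∑ j : Fin (n - 1), |Mmat n i j|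

theorem sum_ite_aux (a b : ℝ) (i m : ℕ) (h : i ≤ m) :
    ∑ j ∈ Finset.range m, (if i ≤ j then a else b) = ((m : ℝ) - i) * a + i * b := by
  induction m, h using Nat.le_induction with
  | base =>
    rw [Finset.sum_congr rfl (g := fun _ => b)]
    · simp
    · intro j hj
      have := Finset.mem_range.1 hj
      rw [if_neg (by omega)]
  | succ m hm ih =>
    rw [Finset.sum_range_succ, ih, if_pos hm]
    push_cast
    ring

theorem row_sum_aux (n : ℕ) (hn : 2 ≤ n) (i : Fin (n - 1)) :
    ∑ j : Fin (n - 1), |Mmat n i j| =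
      (1 / n) * (-2 * ((i : ℕ) + 1 : ℝ) ^ 2 + (2 * n + 1) * ((i : ℕ) + 1 : ℝ) - n) := by
  have hn0 : (0 : ℝ) < n := by exact_mod_cast (by omega : 0 < n)
  have hi : ((i : ℕ) : ℝ) + 1 ≤ n := by
    have := i.2
    exact_mod_cast (by omega : (i : ℕ) + 1 ≤ n)
  have h1 : ∀ j : Fin (n - 1), |Mmat n i j| =
      (fun k : ℕ => if (i : ℕ) ≤ k then ((i : ℕ) + 1 : ℝ) / n
        else ((n : ℝ) - ((i : ℕ) + 1)) / n) (j : ℕ) := by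
    intro j
    simp only [Mmat]
    split_ifs
    · exact abs_of_nonneg (by positivity)
    · rw [neg_div, abs_neg]
      exact abs_of_nonneg (div_nonneg (by linarith) hn0.le)
  rw [Finset.sum_congr rfl (fun j _ => h1 j),
    Fin.sum_univ_eq_sum_range (fun k : ℕ => if (i : ℕ) ≤ k then ((i : ℕ) + 1 : ℝ) / n
        else ((n : ℝ) - ((i : ℕ) + 1)) / n) (n - 1), sum_ite_aux _ _ _ _ i.2.le,
    Nat.cast_sub (by omega)]
  field_simp
  push_cast
  ring

/-- The row-sum norm of `M` equals
`(1/n) * max( z(⌊n/2 + 1/4⌋, n), z(⌈n/2 + 1/4⌉, n) )` with `z(u,n) = -2u² + (2n+1)u - n`. -/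
theorem rowSumNorm_eq (n : ℕ) (hn : 2 ≤ n) :
    rowSumNorm n =
      (1 / n) * max
        (-2 * ((⌊(n : ℝ) / 2 + 1 / 4⌋ : ℤ) : ℝ) ^ 2
          + (2 * n + 1) * ((⌊(n : ℝ) / 2 + 1 / 4⌋ : ℤ) : ℝ) - n)
        (-2 * ((⌈(n : ℝ) / 2 + 1 / 4⌉ : ℤ) : ℝ) ^ 2
          + (2 * n + 1) * ((⌈(n : ℝ) / 2 + 1 / 4⌉ : ℤ) : ℝ) - n) := by
  have hn0 : (0 : ℝ) < n := by exact_mod_cast (by omega : 0 < n)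
  have : Nonempty (Fin (n - 1)) := ⟨⟨0, by omega⟩⟩
  unfold rowSumNorm
  simp only [row_sum_aux n hn]
  have hbdd : BddAbove (Set.range fun i : Fin (n - 1) =>
      (1 / n : ℝ) * (-2 * ((i : ℕ) + 1 : ℝ) ^ 2 + (2 * n + 1) * ((i : ℕ) + 1 : ℝ) - n)) :=
    (Set.finite_range _).bddAbove
  rcases Nat.even_or_odd' n with ⟨k, hk | hk⟩
  · have hf : ⌊(n : ℝ) / 2 + 1 / 4⌋ = (k : ℤ) := by
      rw [Int.floor_eq_iff, hk]; push_cast; constructor <;> linarith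
    have hc : ⌈(n : ℝ) / 2 + 1 / 4⌉ = (k : ℤ) + 1 := by
      rw [Int.ceil_eq_iff, hk]; push_cast; constructor <;> linarith
    have hkn : (n : ℝ) = 2 * k := by rw [hk]; push_cast; ring
    rw [hf, hc, max_eq_left (by push_cast; rw [hkn]; nlinarith)]
    apply le_antisymm
    · refine ciSup_le fun i => mul_le_mul_of_nonneg_left ?_ (by positivity)
      push_cast
      rw [hkn]
      rcases le_or_gt k ((i : ℕ) + 1) with h | h
      · have h' : (k : ℝ) ≤ (i : ℕ) + 1 := by exact_mod_cast h
        nlinarith [mul_nonneg (sub_nonneg.2 h') (sub_nonneg.2 h'), sq_nonneg ((i : ℕ) + 1 - k - 1 : ℝ),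
          (by
            rcases Nat.eq_or_lt_of_le h with e | e
            · have e' : (k : ℝ) = (i : ℕ) + 1 := by exact_mod_cast e
              rw [e']; simp
            · have e' : (k : ℝ) + 1 ≤ (i : ℕ) + 1 := by exact_mod_cast e
              nlinarith : ((i : ℕ) + 1 - k : ℝ) ≤ ((i : ℕ) + 1 - k : ℝ) ^ 2)]
      · have h' : ((i : ℕ) : ℝ) + 1 + 1 ≤ k := by exact_mod_cast h
        nlinarith
    · refine le_trans (le_of_eq ?_) (le_ciSup hbdd ⟨k - 1, by omega⟩)
      simp only
      rw [Nat.cast_sub (by omega)]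
      push_cast
      ring
  · have hf : ⌊(n : ℝ) / 2 + 1 / 4⌋ = (k : ℤ) := by
      rw [Int.floor_eq_iff, hk]; push_cast; constructor <;> linarith
    have hc : ⌈(n : ℝ) / 2 + 1 / 4⌉ = (k : ℤ) + 1 := by
      rw [Int.ceil_eq_iff, hk]; push_cast; constructor <;> linarith
    have hkn : (n : ℝ) = 2 * k + 1 := by rw [hk]; push_cast; ring
    rw [hf, hc, max_eq_right (by push_cast; rw [hkn]; nlinarith)]
    apply le_antisymm
    · refine ciSup_le fun i => mul_le_mul_of_nonneg_left ?_ (by positivity)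
      push_cast
      rw [hkn]
      rcases le_or_gt k (i : ℕ) with h | h
      · have h' : (k : ℝ) ≤ (i : ℕ) := by exact_mod_cast h
        nlinarith
      · have h' : ((i : ℕ) : ℝ) + 1 ≤ k := by exact_mod_cast h
        nlinarith
    · refine le_trans (le_of_eq ?_) (le_ciSup hbdd ⟨k, by omega⟩)
      push_cast
      ring
end

section
/- Let n ≥ 2 be an integer and b_1 ∈ ℂ with b_1 ≠ 0. Let M₁ be the (n−1)×(n−1) complex matrix with (M₁)_{11} = 2b_1, (M₁)_{ii} = b_1 for 2 ≤ i ≤ n−1, (M₁)_{i,i+1} = −1 for 1 ≤ i ≤ n−2, (M₁)_{i,1} = b_1^{i} for 2 ≤ i ≤ n−1, and all other entries 0. Let C be the (n−1)×(n−1) complex matrix with entries C_{ij} = i · b_1^{n+i−j−2} / (n · b_1^{n−1}) if i ≤ j and C_{ij} = −(n−i) · b_1^{n+i−j−2} / (n · b_1^{n−1}) if i > j. Then M₁ · C = I and C · M₁ = I, i.e. C = M₁^{−1}. -/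
open Finset

/-- The `(n-1) × (n-1)` complex matrix `M₁` with (1-based indices) `(M₁)_{11} = 2b₁`,
`(M₁)_{ii} = b₁` for `i ≥ 2`, `(M₁)_{i,i+1} = -1`, `(M₁)_{i,1} = b₁^i` for `i ≥ 2`,
and zeros elsewhere. -/
def M1mat (n : ℕ) (b1 : ℂ) : Matrix (Fin (n - 1)) (Fin (n - 1)) ℂ :=
  fun i j =>
    if (i : ℕ) = 0 ∧ (j : ℕ) = 0 then 2 * b1
    else if (i : ℕ) = (j : ℕ) then b1
    else if (j : ℕ) = (i : ℕ) + 1 then -1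
    else if (j : ℕ) = 0 then b1 ^ ((i : ℕ) + 1)
    else 0

/-- The candidate inverse: `C_{ij} = i b₁^{n+i-j-2} / (n b₁^{n-1})` for `i ≤ j`, and
`C_{ij} = -(n-i) b₁^{n+i-j-2} / (n b₁^{n-1})` for `i > j` (1-based indices). -/
noncomputable def M1inv (n : ℕ) (b1 : ℂ) : Matrix (Fin (n - 1)) (Fin (n - 1)) ℂ :=
  fun i j =>
    if (i : ℕ) ≤ (j : ℕ) then
      (((i : ℕ) + 1 : ℕ) : ℂ) * b1 ^ (n + (i : ℕ) - (j : ℕ) - 2) / ((n : ℂ) * b1 ^ (n - 1))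
    else
      -((n : ℂ) - (((i : ℕ) + 1 : ℕ) : ℂ)) * b1 ^ (n + (i : ℕ) - (j : ℕ) - 2) /
        ((n : ℂ) * b1 ^ (n - 1))

/-- Closed form of the entries of `C` on natural indices. -/
noncomputable def gC (m : ℕ) (b : ℂ) (i j : ℕ) : ℂ :=
  b ^ (m - 1 - j + i) / (((m : ℂ) + 1) * b ^ m) *
    (if i ≤ j then (i : ℂ) + 1 else (i : ℂ) - m)

lemma M1inv_eq (m : ℕ) (b : ℂ) (i j : Fin (m + 1 - 1)) :
    M1inv (m + 1) b i j = gC m b i j := by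
  have hj : (j : ℕ) < m := j.2
  have e : m + 1 + (i : ℕ) - (j : ℕ) - 2 = m - 1 - j + i := by omega
  unfold M1inv gC
  rw [e]
  simp only [show b ^ (m + 1 - 1) = b ^ m from rfl]
  split_ifs <;> push_cast <;> ring

lemma M1mat_eq (m : ℕ) (b : ℂ) (i j : Fin (m + 1 - 1)) :
    M1mat (m + 1) b i j = (if (j : ℕ) = i then b else 0) - (if (j : ℕ) = i + 1 then 1 else 0)
      + (if (j : ℕ) = 0 then b ^ ((i : ℕ) + 1) else 0) := by
  unfold M1mat
  by_cases h0 : (j : ℕ) = 0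
  · by_cases h1 : (i : ℕ) = 0
    · simp [h0, h1]; ring
    · have h2 : ¬ (0 = (i : ℕ)) := fun h => h1 h.symm
      simp [h0, h1, h2]
  · by_cases h1 : (i : ℕ) = j
    · simp [h0, h1]
    · have h2 : ¬ ((j : ℕ) = (i : ℕ)) := fun h => h1 h.symm
      by_cases h3 : (j : ℕ) = i + 1
      · simp [h3]
      · simp [h0, h1, h2, h3]

lemma M1_mul (m : ℕ) (hm : 1 ≤ m) (b : ℂ) (hb : b ≠ 0) :
    M1mat (m + 1) b * M1inv (m + 1) b = 1 := by
  ext i j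
  have hj : (j : ℕ) < m := j.2
  have hi : (i : ℕ) < m := i.2
  have hm1 : (m : ℂ) + 1 ≠ 0 := by exact_mod_cast Nat.succ_ne_zero m
  rw [Matrix.mul_apply, Matrix.one_apply]
  simp only [M1inv_eq, M1mat_eq]
  rw [Fin.sum_univ_eq_sum_range (fun k : ℕ => ((if k = (i : ℕ) then b else 0)
      - (if k = (i : ℕ) + 1 then 1 else 0)
      + (if k = 0 then b ^ ((i : ℕ) + 1) else 0)) * gC m b k j)]
  simp only [show range (m + 1 - 1) = range m from rfl, add_mul, sub_mul, ite_mul, zero_mul, one_mul, Finset.sum_add_distrib,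
    Finset.sum_sub_distrib, Finset.sum_ite_eq', Finset.mem_range, hi, if_true,
    show 0 < m from hm]
  have hlast : (if (i : ℕ) + 1 < m then gC m b (i + 1) j else 0) = gC m b (i + 1) j := by
    split_ifs with h
    · rfl
    · have e : (i : ℕ) + 1 = m := by omega
      rw [e]; unfold gC; rw [if_neg (by omega)]; simp
  rw [hlast]
  simp only [Fin.ext_iff]
  unfold gC
  have hbm : b ^ m ≠ 0 := pow_ne_zero _ hb
  rcases lt_trichotomy (i : ℕ) (j : ℕ) with h | h | h
  · rw [if_pos h.le, if_pos (by omega), if_pos (by omega), if_neg (by omega)]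
    push_cast; ring
  · rw [if_pos h.le, if_neg (by omega), if_pos (by omega), if_pos h, h]
    have e : b ^ m = b ^ (m - 1 - (j : ℕ) + j) * b := by
      rw [← pow_succ]; congr 1; omega
    rw [e] at hbm ⊢
    have hq : b ^ (m - 1 - (j : ℕ) + j) ≠ 0 := pow_ne_zero _ hb
    rw [← add_assoc, pow_succ, add_zero]
    rw [pow_add] at hq ⊢
    have hq1 : b ^ (m - 1 - (j : ℕ)) ≠ 0 := pow_ne_zero _ hb
    have hq2 : b ^ (j : ℕ) ≠ 0 := pow_ne_zero _ hb
    rw [pow_succ]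
    generalize b ^ (m - 1 - (j : ℕ)) = x at *
    generalize b ^ (j : ℕ) = y at *
    field_simp
    push_cast; ring
  · rw [if_neg (by omega), if_neg (by omega), if_pos (by omega), if_neg (by omega)]
    push_cast; ring

/-- `M₁ · C = I` and `C · M₁ = I`, i.e. `C = M₁⁻¹`. -/
theorem M1_inverse (n : ℕ) (hn : 2 ≤ n) (b1 : ℂ) (hb1 : b1 ≠ 0) :
    M1mat n b1 * M1inv n b1 = 1 ∧ M1inv n b1 * M1mat n b1 = 1 ∧
      M1inv n b1 = (M1mat n b1)⁻¹ := by
  obtain ⟨m, rfl⟩ : ∃ m, n = m + 1 := ⟨n - 1, by omega⟩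
  have h := M1_mul m (by omega) b1 hb1
  exact ⟨h, mul_eq_one_comm.mp h, (Matrix.inv_eq_right_inv h).symm⟩
end

section
/- Let n ≥ 2 be an integer and b_1 ∈ ℂ with b_1 ≠ 0. Let M₁ be the (n−1)×(n−1) complex matrix with (M₁)_{11} = 2b_1, (M₁)_{ii} = b_1 for 2 ≤ i ≤ n−1, (M₁)_{i,i+1} = −1 for 1 ≤ i ≤ n−2, (M₁)_{i,1} = b_1^{i} for 2 ≤ i ≤ n−1, and all other entries 0. Let M be the (n−1)×(n−1) matrix with M_{ij} = i/n for i ≤ j and M_{ij} = −(n−i)/n for i > j, regarded as a complex matrix, and let B = diag(b_1^{n−1}, b_1^{n−2}, …, b_1). Then M₁ · (B^{−1} · M · B) = b_1 · I; equivalently M₁^{−1} = (1/b_1) · B^{−1} · M · B. -/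
open Finset

/-- The `(n-1) × (n-1)` matrix `M` with `M_{ij} = i/n` for `i ≤ j` and `M_{ij} = -(n-i)/n`
for `i > j` (1-based indices), regarded as a complex matrix. -/
noncomputable def McMat (n : ℕ) : Matrix (Fin (n - 1)) (Fin (n - 1)) ℂ :=
  fun i j => if (i : ℕ) ≤ (j : ℕ) then (((i : ℕ) + 1 : ℕ) : ℂ) / n
             else -((n : ℂ) - (((i : ℕ) + 1 : ℕ) : ℂ)) / n

/-- The diagonal matrix `B = diag(b₁^{n-1}, b₁^{n-2}, …, b₁)`. -/
def Bmat (n : ℕ) (b1 : ℂ) : Matrix (Fin (n - 1)) (Fin (n - 1)) ℂ :=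
  Matrix.diagonal fun i : Fin (n - 1) => b1 ^ (n - 1 - (i : ℕ))

theorem Bmat_inv_aux (n : ℕ) (b1 : ℂ) (hb1 : b1 ≠ 0) :
    (Bmat n b1)⁻¹ = Matrix.diagonal fun i : Fin (n - 1) => (b1 ^ (n - 1 - (i : ℕ)))⁻¹ := by
  apply Matrix.inv_eq_left_inv
  rw [Bmat, Matrix.diagonal_mul_diagonal, ← Matrix.diagonal_one]
  congr 1
  funext i
  exact inv_mul_cancel₀ (pow_ne_zero _ hb1)

theorem M1mat_split_aux (n : ℕ) (hn : 2 ≤ n) (b1 : ℂ) (i k : Fin (n - 1)) :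
    M1mat n b1 i k = (if k = i then b1 else 0) + (if (k : ℕ) = (i : ℕ) + 1 then -1 else 0)
      + (if k = ⟨0, by omega⟩ then b1 ^ ((i : ℕ) + 1) else 0) := by
  obtain ⟨i, hi⟩ := i
  obtain ⟨k, hk⟩ := k
  simp only [M1mat, Fin.mk.injEq]
  split_ifs <;> first | omega | (subst_vars; ring)

theorem M1_mul_aux (n : ℕ) (hn : 2 ≤ n) (b1 : ℂ) (hb1 : b1 ≠ 0) :
    M1mat n b1 * ((Bmat n b1)⁻¹ * McMat n * Bmat n b1)
      = b1 • (1 : Matrix (Fin (n - 1)) (Fin (n - 1)) ℂ) := by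
  have hn0 : (n : ℂ) ≠ 0 := by
    have : n ≠ 0 := by omega
    exact_mod_cast this
  ext i j
  rw [Bmat_inv_aux n b1 hb1, Matrix.mul_apply]
  simp only [M1mat_split_aux n hn, add_mul, Finset.sum_add_distrib, ite_mul, zero_mul,
    Finset.sum_ite_eq', Finset.mem_univ, if_true, Bmat, Matrix.mul_diagonal,
    Matrix.diagonal_mul, Matrix.smul_apply, Matrix.one_apply, smul_eq_mul]
  have hM0 : McMat n ⟨0, by omega⟩ j = 1 / n := by simp [McMat]
  rw [hM0]
  have hp0 : b1 ^ (n - 1 - 0) = b1 ^ (n - 1 - (i : ℕ)) * b1 ^ (i : ℕ) := by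
    rw [← pow_add]; congr 1; have := i.2; omega
  simp only [hp0]
  have hs : (∑ k : Fin (n - 1), if (k : ℕ) = (i : ℕ) + 1 then
      -1 * ((b1 ^ (n - 1 - (k : ℕ)))⁻¹ * McMat n k j * b1 ^ (n - 1 - (j : ℕ))) else 0)
      = -(b1 * (b1 ^ (n - 1 - (i : ℕ)))⁻¹ * (if (i : ℕ) + 1 ≤ (j : ℕ) then ((i : ℕ) + 2 : ℂ) / n
          else -((n : ℂ) - ((i : ℕ) + 2 : ℂ)) / n) * b1 ^ (n - 1 - (j : ℕ))) := by
    by_cases h : (i : ℕ) + 1 < n - 1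
    · rw [Finset.sum_eq_single (⟨(i : ℕ) + 1, h⟩ : Fin (n - 1))]
      · have hp : b1 ^ (n - 1 - (i : ℕ)) = b1 ^ (n - 1 - ((i : ℕ) + 1)) * b1 := by
          rw [← pow_succ]; congr 1; omega
        have hne := pow_ne_zero (n - 1 - ((i : ℕ) + 1)) hb1
        simp only [if_true, McMat, hp]
        push_cast
        split_ifs <;> field_simp <;> ring
      · intro k _ hk
        rw [if_neg]
        intro h'
        exact hk (Fin.ext h')
      · simp
    · rw [Finset.sum_eq_zero]
      · have hj := j.2
        have hi := i.2
        have hni : (n : ℂ) = (i : ℕ) + 2 := by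
          have : n = (i : ℕ) + 2 := by omega
          exact_mod_cast this
        rw [if_neg (by omega), hni]
        simp
      · intro k _
        have := k.2
        rw [if_neg (by omega)]
  rw [hs]
  have hne := pow_ne_zero (n - 1 - (i : ℕ)) hb1
  have hne2 := pow_ne_zero (i : ℕ) hb1
  rw [pow_succ]
  rcases lt_trichotomy (i : ℕ) (j : ℕ) with h | h | h
  · have hij : i ≠ j := fun e => by rw [e] at h; exact lt_irrefl _ h
    simp only [McMat, if_pos h.le, if_pos (Nat.succ_le_of_lt h), if_neg hij]
    push_cast
    field_simp
    ring
  · have hij : i = j := Fin.ext h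
    subst hij
    simp only [McMat, le_refl, if_true, if_neg (Nat.not_succ_le_self _)]
    push_cast
    field_simp
    ring
  · have hij : i ≠ j := fun e => by rw [e] at h; exact lt_irrefl _ h
    simp only [McMat, if_neg (not_le.mpr h), if_neg hij]
    rw [if_neg (by omega)]
    push_cast
    field_simp
    ring

/-- `M₁ · (B⁻¹ M B) = b₁ · I`; equivalently `M₁⁻¹ = (1/b₁) · B⁻¹ M B`. -/
theorem M1_inv_conjugation (n : ℕ) (hn : 2 ≤ n) (b1 : ℂ) (hb1 : b1 ≠ 0) :
    M1mat n b1 * ((Bmat n b1)⁻¹ * McMat n * Bmat n b1) = b1 • (1 : Matrix (Fin (n - 1)) (Fin (n - 1)) ℂ) ∧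
      (M1mat n b1)⁻¹ = (1 / b1) • ((Bmat n b1)⁻¹ * McMat n * Bmat n b1) := by
  refine ⟨M1_mul_aux n hn b1 hb1, ?_⟩
  apply Matrix.inv_eq_right_inv
  rw [Matrix.mul_smul, M1_mul_aux n hn b1 hb1, smul_smul, one_div, inv_mul_cancel₀ hb1, one_smul]
end

section
/- Let n ≥ 2, let a_0 = ρ e^{iθ} (ρ > 0, −π < θ ≤ π) and a_1, …, a_{n−1} ∈ ℂ, fix k ∈ {0, 1, …, n−1}, and set b_1 = ρ^{1/n} e^{i(θ+2kπ)/n}. Define (n−1)-dimensional complex column vectors V(q) recursively by V(1) = (b_1, b_1², …, b_1^{n−1})ᵀ and, for q ≥ 2, V(q) = −M₁^{−1} · (Σ_{m=2}^{q−1} V(m)_1 · V(q−m+1)) + ( Σ_{p=1}^{min(n−1, q−1)} a_p · V(q−p)_p / (n b_1^{n−1}) ) · (1, 2b_1, 3b_1², …, (n−1)b_1^{n−2})ᵀ, where M₁ is the (n−1)×(n−1) matrix with (M₁)_{11} = 2b_1, (M₁)_{ii} = b_1 for i ≥ 2, (M₁)_{i,i+1} = −1, (M₁)_{i,1} = b_1^{i}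 for i ≥ 2, and zeros elsewhere, and V(m)_s denotes the s-th component. Let B = diag(b_1^{n−1}, …, b_1). Then for every q ≥ 1 the vector b_1^{1−q} · B · V(q) equals W(q), where W is the sequence defined by the recursion W(1) = a_0·(1,…,1)ᵀ, W(2) = (a_1/n)·(1,2,…,n−1)ᵀ, W(q) = (1/a_0)·( −M · Σ_{p=1}^{q−2} W(p+1)_1 · W(q−p) + (Σ_{p=1}^{min(n−1,q−1)} a_p · W(q−p)_p) · U ) for q ≥ 3 (which does not involve k); consequently, the first component satisfies V(q)_1 = β_q · e^{2kπq·i/n} with β_q = ρ^{q/n} · e^{iqθ/n} · W(q)_1 / a_0. -/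
open Finset Real

/-- The `(n-1)`-dimensional column vector `U = (1/n) (1, 2, …, n-1)ᵀ`. -/
noncomputable def Uvec (n : ℕ) : Fin (n - 1) → ℂ :=
  fun i => (((i : ℕ) + 1 : ℕ) : ℂ) / n

/-- The entries of the inverse of `M1mat`, as a function of natural indices. -/
noncomputable def Nent (n : ℕ) (b : ℂ) (l j : ℕ) : ℂ :=
  b ^ ((l : ℤ) - (j : ℤ) - 1) * (((l : ℂ) + 1) / n - if j < l then 1 else 0)

lemma Nent_mul (n : ℕ) (hn : 2 ≤ n) (b : ℂ) (hb : b ≠ 0) :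
    M1mat n b * (Matrix.of fun i j : Fin (n - 1) => Nent n b i j) = 1 := by
  have hn0 : (n : ℂ) ≠ 0 := by
    have : n ≠ 0 := by omega
    exact_mod_cast this
  have hM : ∀ i l : Fin (n - 1), M1mat n b i l =
      (if l = (⟨0, by omega⟩ : Fin (n - 1)) then b ^ ((i : ℕ) + 1) else 0) +
      (if l = i then b else 0) + (if (l : ℕ) = (i : ℕ) + 1 then -1 else 0) := by
    intro i l
    simp only [M1mat, Fin.ext_iff]
    split_ifs <;> first | omega | ring1 | (rw [show (i : ℕ) = 0 by omega]; ring1)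
  ext i j
  rw [Matrix.mul_apply]
  simp only [hM, Matrix.of_apply, add_mul, Finset.sum_add_distrib, ite_mul, zero_mul, Finset.sum_ite_eq',
    Finset.sum_ite_eq, Finset.mem_univ, if_true]
  have hlast : (∑ l : Fin (n - 1), if (l : ℕ) = (i : ℕ) + 1 then -1 * Nent n b l j else 0)
      = - Nent n b ((i : ℕ) + 1) j := by
    by_cases h : (i : ℕ) + 1 < n - 1
    · rw [Finset.sum_eq_single (⟨(i : ℕ) + 1, h⟩ : Fin (n - 1))]
      · simp
      · intro l _ hl
        rw [if_neg]
        intro h'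
        exact hl (Fin.ext h')
      · simp
    · rw [Finset.sum_eq_zero]
      · have h1 : (i : ℕ) + 1 = n - 1 := by have := i.2; omega
        have h2 : (j : ℕ) < n - 1 := j.2
        have h3 : (((n - 1 : ℕ) : ℂ) + 1) = n := by
          have : n - 1 + 1 = n := by omega
          exact_mod_cast this
        rw [h1, Nent, if_pos h2, h3, div_self hn0]
        simp
      · intro l _
        rw [if_neg]
        have := l.2
        omega
  rw [hlast, Matrix.one_apply]
  have e1 : b ^ ((i : ℕ) + 1) * b ^ (((0 : ℕ) : ℤ) - (j : ℕ) - 1) = b ^ (((i : ℕ) : ℤ) - (j : ℕ)) := by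
    rw [← zpow_natCast, ← zpow_add₀ hb]; congr 1; push_cast; ring
  have e2 : b * b ^ (((i : ℕ) : ℤ) - (j : ℕ) - 1) = b ^ (((i : ℕ) : ℤ) - (j : ℕ)) := by
    rw [← zpow_one_add₀ hb]; congr 1; ring
  have e3 : b ^ ((((i : ℕ) + 1 : ℕ) : ℤ) - (j : ℕ) - 1) = b ^ (((i : ℕ) : ℤ) - (j : ℕ)) := by
    congr 1; push_cast; ring
  simp only [Nent]
  rw [← mul_assoc, e1, ← mul_assoc, e2, e3, ← mul_add, ← sub_eq_add_neg, ← mul_sub]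
  push_cast
  rcases lt_trichotomy (i : ℕ) (j : ℕ) with h | h | h
  · rw [if_neg (by omega), if_neg (by omega), if_neg (by omega),
      if_neg (by intro h'; rw [h'] at h; omega)]
    ring
  · rw [if_neg (by omega), if_neg (by omega), if_pos (by omega), if_pos (Fin.ext h), h]
    simp
    ring
  · rw [if_neg (by omega), if_pos (by omega), if_pos (by omega),
      if_neg (by intro h'; rw [h'] at h; omega)]
    ring

lemma M1_inv (n : ℕ) (hn : 2 ≤ n) (b : ℂ) (hb : b ≠ 0) (i j : Fin (n - 1)) :
    (M1mat n b)⁻¹ i j = b ^ (((i : ℕ) : ℤ) - ((j : ℕ) : ℤ) - 1) * McMat n i j := by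
  have hn0 : (n : ℂ) ≠ 0 := by
    have : n ≠ 0 := by omega
    exact_mod_cast this
  rw [Matrix.inv_eq_right_inv (Nent_mul n hn b hb)]
  simp only [Nent, McMat, Matrix.of_apply]
  congr 1
  split_ifs <;> first | omega | (push_cast; field_simp; try ring)

lemma V_eq (n : ℕ) (hn : 2 ≤ n) (a : ℕ → ℂ) (b1 : ℂ) (hb : b1 ≠ 0) (hbn : b1 ^ n = a 0)
    (V : ℕ → Fin (n - 1) → ℂ)
    (hV1 : V 1 = fun i : Fin (n - 1) => b1 ^ ((i : ℕ) + 1))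
    (hVrec : ∀ q : ℕ, 2 ≤ q → V q =
      -(Matrix.mulVec (M1mat n b1)⁻¹
          (∑ m ∈ Finset.Icc 2 (q - 1), V m ⟨0, by omega⟩ • V (q - m + 1)))
      + ((∑ p : Fin (n - 1),
            if (p : ℕ) + 1 ≤ min (n - 1) (q - 1) then
              a ((p : ℕ) + 1) * V (q - ((p : ℕ) + 1)) p else 0) / ((n : ℂ) * b1 ^ (n - 1))) •
          (fun i : Fin (n - 1) => (((i : ℕ) + 1 : ℕ) : ℂ) * b1 ^ (i : ℕ)))
    (W : ℕ → Fin (n - 1) → ℂ)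
    (hW1 : W 1 = fun _ => a 0)
    (hW2 : W 2 = fun i : Fin (n - 1) => (a 1 / n) * (((i : ℕ) + 1 : ℕ) : ℂ))
    (hWrec : ∀ q : ℕ, 3 ≤ q → W q =
      (1 / a 0) •
        (-(Matrix.mulVec (McMat n)
            (∑ p ∈ Finset.Icc 1 (q - 2), W (p + 1) ⟨0, by omega⟩ • W (q - p)))
         + (∑ p : Fin (n - 1),
              if (p : ℕ) + 1 ≤ min (n - 1) (q - 1) then
                a ((p : ℕ) + 1) * W (q - ((p : ℕ) + 1)) p else 0) • Uvec n)) :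
    ∀ q : ℕ, 1 ≤ q → ∀ i : Fin (n - 1),
      V q i = b1 ^ ((q : ℤ) - (n : ℤ) + ((i : ℕ) : ℤ)) * W q i := by
  have hn0 : (n : ℂ) ≠ 0 := by
    have : n ≠ 0 := by omega
    exact_mod_cast this
  have ha : a 0 = b1 ^ (n : ℤ) := by rw [← hbn, zpow_natCast]
  have hn1 : b1 ^ (n - 1) = b1 ^ ((n : ℤ) - 1) := by
    rw [← zpow_natCast]; congr 1; push_cast [show 1 ≤ n by omega]; ring
  intro q
  induction q using Nat.strong_induction_on with
  | _ q ih =>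
  intro hq i
  rcases (show q = 1 ∨ q = 2 ∨ 3 ≤ q by omega) with rfl | rfl | hq3
  · rw [hV1, hW1, ha]
    simp only
    rw [← zpow_add₀ hb, ← zpow_natCast]
    congr 1; push_cast; ring
  · rw [hVrec 2 le_rfl, hW2]
    have hs : (∑ p : Fin (n - 1),
            if (p : ℕ) + 1 ≤ min (n - 1) (2 - 1) then
              a ((p : ℕ) + 1) * V (2 - ((p : ℕ) + 1)) p else 0) = a 1 * b1 := by
      rw [Finset.sum_eq_single (⟨0, by omega⟩ : Fin (n - 1))]
      · rw [if_pos (by simp; omega)]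
        simp [hV1]
      · intro p _ hp
        rw [if_neg]
        intro h
        apply hp
        apply Fin.ext
        simp only
        omega
      · simp
    rw [hs, show Finset.Icc 2 (2 - 1) = ∅ by simp]
    simp only [Finset.sum_empty, Matrix.mulVec_zero, neg_zero, zero_add, Pi.smul_apply, smul_eq_mul]
    rw [hn1, show ((2 : ℕ) : ℤ) - (n : ℤ) + ((i : ℕ) : ℤ) = 1 + ((i : ℕ) : ℤ) - ((n : ℤ) - 1) by
      push_cast; ring, zpow_sub₀ hb (1 + ((i : ℕ) : ℤ)), zpow_add₀ hb, zpow_natCast, zpow_one]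
    have := zpow_ne_zero ((n : ℤ) - 1) hb
    field_simp
  · rw [hVrec q (by omega), hWrec q hq3]
    have hs : (∑ p : Fin (n - 1),
            if (p : ℕ) + 1 ≤ min (n - 1) (q - 1) then
              a ((p : ℕ) + 1) * V (q - ((p : ℕ) + 1)) p else 0)
          = b1 ^ ((q : ℤ) - n - 1) * ∑ p : Fin (n - 1),
            if (p : ℕ) + 1 ≤ min (n - 1) (q - 1) then
              a ((p : ℕ) + 1) * W (q - ((p : ℕ) + 1)) p else 0 := by
      rw [Finset.mul_sum]
      refine Finset.sum_congr rfl fun p _ => ?_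
      split_ifs with h
      · rw [ih _ (by omega) (by omega),
          show (((q - ((p : ℕ) + 1) : ℕ) : ℤ) - (n : ℤ) + ((p : ℕ) : ℤ)) = (q : ℤ) - n - 1 by
            rw [Nat.cast_sub (by omega)]; push_cast; ring]
        ring
      · simp
    have hquad : ∀ j : Fin (n - 1),
        (∑ m ∈ Finset.Icc 2 (q - 1), V m ⟨0, by omega⟩ • V (q - m + 1)) j
        = b1 ^ ((q : ℤ) + 1 - 2 * n + ((j : ℕ) : ℤ)) *
          (∑ p ∈ Finset.Icc 1 (q - 2), W (p + 1) ⟨0, by omega⟩ • W (q - p)) j := by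
      intro j
      rw [Finset.sum_apply, Finset.sum_apply, Finset.mul_sum]
      symm
      refine Finset.sum_bij (fun p _ => p + 1) ?_ ?_ ?_ ?_
      · intro p hp
        simp only [Finset.mem_Icc] at hp ⊢
        omega
      · intro p _ p' _ h
        simpa using h
      · intro m hm
        simp only [Finset.mem_Icc] at hm
        exact ⟨m - 1, by simp only [Finset.mem_Icc]; omega, by omega⟩
      · intro p hp
        simp only [Finset.mem_Icc] at hp
        rw [show q - (p + 1) + 1 = q - p by omega]
        simp only [Pi.smul_apply, smul_eq_mul]
        rw [ih (p + 1) (by omega) (by omega), ih (q - p) (by omega) (by omega),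
          show (q : ℤ) + 1 - 2 * n + ((j : ℕ) : ℤ) =
            (((p + 1 : ℕ) : ℤ) - n + ((0 : ℕ) : ℤ)) + (((q - p : ℕ) : ℤ) - n + ((j : ℕ) : ℤ)) by
            rw [Nat.cast_sub (by omega)]; push_cast; ring, zpow_add₀ hb]
        ring
    have hmv : ((M1mat n b1)⁻¹.mulVec
          (∑ m ∈ Finset.Icc 2 (q - 1), V m ⟨0, by omega⟩ • V (q - m + 1))) i
        = b1 ^ ((q : ℤ) - 2 * n + ((i : ℕ) : ℤ)) * ((McMat n).mulVec
          (∑ p ∈ Finset.Icc 1 (q - 2), W (p + 1) ⟨0, by omega⟩ • W (q - p))) i := by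
      simp only [Matrix.mulVec, dotProduct]
      rw [Finset.mul_sum]
      refine Finset.sum_congr rfl fun j _ => ?_
      rw [hquad, M1_inv n hn b1 hb, show (q : ℤ) - 2 * n + ((i : ℕ) : ℤ) =
        (((i : ℕ) : ℤ) - ((j : ℕ) : ℤ) - 1) + ((q : ℤ) + 1 - 2 * n + ((j : ℕ) : ℤ)) by ring,
        zpow_add₀ hb (((i : ℕ) : ℤ) - ((j : ℕ) : ℤ) - 1)]
      ring
    rw [hs]
    simp only [Pi.add_apply, Pi.neg_apply, Pi.smul_apply, smul_eq_mul]
    rw [hmv, ha, hn1]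
    simp only [Uvec]
    generalize ((McMat n).mulVec
          (∑ p ∈ Finset.Icc 1 (q - 2), W (p + 1) ⟨0, by omega⟩ • W (q - p))) i = X
    generalize (∑ p : Fin (n - 1), if (p : ℕ) + 1 ≤ min (n - 1) (q - 1) then
              a ((p : ℕ) + 1) * W (q - ((p : ℕ) + 1)) p else 0) = Y
    rw [show (q : ℤ) - 2 * n + ((i : ℕ) : ℤ) = (q : ℤ) + ((i : ℕ) : ℤ) - n - n by ring,
      show (q : ℤ) - n + ((i : ℕ) : ℤ) = (q : ℤ) + ((i : ℕ) : ℤ) - n by ring]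
    simp only [zpow_sub₀ hb, zpow_add₀ hb, zpow_one, zpow_natCast]
    field_simp
    try ring

/-- Change of variable `W(q) = b₁^{1-q} B V(q)` on the dynamical system `V`, and the resulting
form `V(q)₁ = β_q e^{2kπq i/n}` with `β_q = ρ^{q/n} e^{iqθ/n} W(q)₁ / a₀`. -/
theorem V_change_of_variable (n : ℕ) (hn : 2 ≤ n) (ρ θ : ℝ) (hρ : 0 < ρ)
    (hθ₁ : -π < θ) (hθ₂ : θ ≤ π) (a : ℕ → ℂ)
    (ha0 : a 0 = (ρ : ℂ) * Complex.exp ((θ : ℂ) * Complex.I))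
    (k : ℕ) (hk : k < n) (b1 : ℂ)
    (hb1 : b1 = ((ρ ^ ((1 : ℝ) / n) : ℝ) : ℂ) *
      Complex.exp ((((θ + 2 * k * π) / n : ℝ) : ℂ) * Complex.I))
    (V : ℕ → Fin (n - 1) → ℂ)
    (hV1 : V 1 = fun i : Fin (n - 1) => b1 ^ ((i : ℕ) + 1))
    (hVrec : ∀ q : ℕ, 2 ≤ q → V q =
      -(Matrix.mulVec (M1mat n b1)⁻¹
          (∑ m ∈ Finset.Icc 2 (q - 1), V m ⟨0, by omega⟩ • V (q - m + 1)))
      + ((∑ p : Fin (n - 1),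
            if (p : ℕ) + 1 ≤ min (n - 1) (q - 1) then
              a ((p : ℕ) + 1) * V (q - ((p : ℕ) + 1)) p else 0) / ((n : ℂ) * b1 ^ (n - 1))) •
          (fun i : Fin (n - 1) => (((i : ℕ) + 1 : ℕ) : ℂ) * b1 ^ (i : ℕ)))
    (W : ℕ → Fin (n - 1) → ℂ)
    (hW1 : W 1 = fun _ => a 0)
    (hW2 : W 2 = fun i : Fin (n - 1) => (a 1 / n) * (((i : ℕ) + 1 : ℕ) : ℂ))
    (hWrec : ∀ q : ℕ, 3 ≤ q → W q =
      (1 / a 0) •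
        (-(Matrix.mulVec (McMat n)
            (∑ p ∈ Finset.Icc 1 (q - 2), W (p + 1) ⟨0, by omega⟩ • W (q - p)))
         + (∑ p : Fin (n - 1),
              if (p : ℕ) + 1 ≤ min (n - 1) (q - 1) then
                a ((p : ℕ) + 1) * W (q - ((p : ℕ) + 1)) p else 0) • Uvec n)) :
    ∀ q : ℕ, 1 ≤ q →
      (b1 ^ ((1 : ℤ) - (q : ℤ))) •
          Matrix.mulVec (Matrix.diagonal fun i : Fin (n - 1) => b1 ^ (n - 1 - (i : ℕ))) (V q)
        = W q
      ∧ V q ⟨0, by omega⟩ =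
          ((ρ ^ ((q : ℝ) / n) : ℝ) : ℂ) *
            Complex.exp ((((q : ℝ) * θ / n : ℝ) : ℂ) * Complex.I) * W q ⟨0, by omega⟩ / a 0 *
            Complex.exp (((2 * k * π * q / n : ℝ) : ℂ) * Complex.I) := by
  have hnR : (n : ℝ) ≠ 0 := by
    have : n ≠ 0 := by omega
    exact_mod_cast this
  have hnC : (n : ℂ) ≠ 0 := by exact_mod_cast hnR
  have hpow : ∀ q : ℕ, b1 ^ q = ((ρ ^ ((q : ℝ) / n) : ℝ) : ℂ) *
            Complex.exp ((((q : ℝ) * θ / n : ℝ) : ℂ) * Complex.I) *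
            Complex.exp (((2 * k * π * q / n : ℝ) : ℂ) * Complex.I) := by
    intro q
    rw [hb1, mul_pow, ← Complex.exp_nat_mul, mul_assoc ((ρ ^ ((q : ℝ) / n) : ℝ) : ℂ),
      ← Complex.exp_add]
    congr 1
    · rw [← Complex.ofReal_pow, ← Real.rpow_natCast, ← Real.rpow_mul hρ.le]
      congr 2
      ring
    · congr 1
      push_cast
      ring
  have hb : b1 ≠ 0 := by
    rw [hb1]
    refine mul_ne_zero ?_ (Complex.exp_ne_zero _)
    exact_mod_cast (Real.rpow_pos_of_pos hρ _).ne'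
  have hbn : b1 ^ n = a 0 := by
    rw [hpow n, ha0, div_self hnR, Real.rpow_one]
    have h1 : (((n : ℝ) * θ / n : ℝ) : ℂ) = θ := by
      push_cast
      field_simp
    have h2 : ((2 * k * π * n / n : ℝ) : ℂ) * Complex.I = k * (2 * π * Complex.I) := by
      push_cast
      field_simp
    rw [h1, h2, Complex.exp_nat_mul_two_pi_mul_I, mul_one]
  have hne : a 0 ≠ 0 := by rw [← hbn]; exact pow_ne_zero _ hb
  have key := V_eq n hn a b1 hb hbn V hV1 hVrec W hW1 hW2 hWrec
  intro q hq
  constructor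
  · ext i
    simp only [Pi.smul_apply, Matrix.mulVec_diagonal, smul_eq_mul]
    have hi : (i : ℕ) < n - 1 := i.2
    rw [key q hq i, ← mul_assoc, ← mul_assoc, ← zpow_natCast, ← zpow_add₀ hb, ← zpow_add₀ hb,
      show (1 : ℤ) - q + ((n - 1 - (i : ℕ) : ℕ) : ℤ) + ((q : ℤ) - n + ((i : ℕ) : ℤ)) = 0 by omega,
      zpow_zero, one_mul]
  · rw [key q hq]
    have : b1 ^ ((q : ℤ) - n + ((0 : ℕ) : ℤ)) = b1 ^ q / a 0 := by
      rw [← hbn, Nat.cast_zero, add_zero, zpow_sub₀ hb, zpow_natCast, zpow_natCast]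
    simp only [this]
    rw [hpow q]
    ring
end
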